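/- Let n0, n1, d ≥ 1 and let g : ℝ^(n0+n1) → Sym⁺_d(ℝ) be a C² N-log-concave function such that ∫_{ℝ^{n1}} |g(t,y)| dy < ∞ for every t ∈ ℝ^{n0} (|·| any norm on d×d matrices). Define α(t) := ∫_{ℝ^{n1}} g(t,y) dy ∈ Sym⁺_d(ℝ), and assume α is C² with values in the positive definite matrices, with first and second partial derivatives given by differentiating under the integral sign: ∂_{t_j}α(t) = ∫ ∂_{t_j}g(t,y) dy and ∂²_{t_j t_k}α(t) = ∫ ∂²_{t_j t_k}g(t,y) dy. Then α is N-log-concave on ℝ^{n0}. -/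

import Mathlib

open Matrix MeasureTheory

noncomputable section

/-- Entrywise partial derivative, in direction `x_j`, of a matrix-valued function. -/
def mpd {n d : ℕ} (j : Fin n) (g : (Fin n → ℝ) → Matrix (Fin d) (Fin d) ℝ)
    (x : Fin n → ℝ) : Matrix (Fin d) (Fin d) ℝ :=
  Matrix.of fun i k => fderiv ℝ (fun y => g y i k) x (Pi.single j 1)

/-- `θ^g_{j,k}(x) = g(x)⁻¹ (∂²_{x_k x_j} g(x) − (∂_{x_k} g)(x) g(x)⁻¹ (∂_{x_j} g)(x))`. -/
def theta {n d : ℕ} (g : (Fin n → ℝ) → Matrix (Fin d) (Fin d) ℝ) (j k : Fin n)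
    (x : Fin n → ℝ) : Matrix (Fin d) (Fin d) ℝ :=
  (g x)⁻¹ * (mpd k (mpd j g) x - mpd k g x * (g x)⁻¹ * mpd j g x)

/-- The operator `Θ^g(x)` on `M_{d,n}(ℝ)`: a `d×n` matrix is encoded by its columns
`U : Fin n → Fin d → ℝ`, and the `k`-th column of `Θ^g(x) U` is `Σ_j θ^g_{j,k}(x) u_j`. -/
def ThetaOp {n d : ℕ} (g : (Fin n → ℝ) → Matrix (Fin d) (Fin d) ℝ)
    (x : Fin n → ℝ) (U : Fin n → Fin d → ℝ) : Fin n → Fin d → ℝ :=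
  fun k => ∑ j, (theta g j k x).mulVec (U j)

/-- `⟨U,V⟩_{id_n ⊗ a} = Σ_k ⟨a u_k, v_k⟩` on `M_{d,n}(ℝ)` (matrices given by columns). -/
def minner {n d : ℕ} (a : Matrix (Fin d) (Fin d) ℝ)
    (U V : Fin n → Fin d → ℝ) : ℝ :=
  ∑ k, a.mulVec (U k) ⬝ᵥ V k

/-- `‖u‖²_a = ⟨a u, u⟩` on `ℝ^d`. -/
def vnormSq {d : ℕ} (a : Matrix (Fin d) (Fin d) ℝ) (u : Fin d → ℝ) : ℝ :=
  a.mulVec u ⬝ᵥ u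

/-- N-log-concavity: `⟨Θ^g(x) U, U⟩_{id_n ⊗ g(x)} ≤ 0` for all `x` and `U`. -/
def NLogConcave {n d : ℕ} (g : (Fin n → ℝ) → Matrix (Fin d) (Fin d) ℝ) : Prop :=
  ∀ (x : Fin n → ℝ) (U : Fin n → Fin d → ℝ), minner (g x) (ThetaOp g x U) U ≤ 0

/-- Entrywise `C^k` smoothness of a matrix-valued function. -/
def MatCD {n d : ℕ} (k : ℕ) (g : (Fin n → ℝ) → Matrix (Fin d) (Fin d) ℝ) : Prop :=
  ∀ i j, ContDiff ℝ k fun y => g y i j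

/-- Polar of a nonnegative quadratic form `Q` with respect to a bilinear pairing `inn`:
`Q°(v) = sup { ⟨u,v⟩² : Q(u) ≤ 1 }`. -/
def polar {E : Type*} (inn : E → E → ℝ) (Q : E → ℝ) (v : E) : ℝ :=
  sSup {r | ∃ u, Q u ≤ 1 ∧ r = inn u v ^ 2}

/-- Partial derivative `∂_{x_j} F` of a vector-valued function. -/
def pdF {n d : ℕ} (j : Fin n) (F : (Fin n → ℝ) → Fin d → ℝ) (x : Fin n → ℝ) : Fin d → ℝ :=
  fun i => fderiv ℝ (fun y => F y i) x (Pi.single j 1)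

/-- `∇_x F = [∂_{x_1} F, …, ∂_{x_n} F] ∈ M_{d,n}(ℝ)`, encoded by columns. -/
def gradM {n d : ℕ} (F : (Fin n → ℝ) → Fin d → ℝ) (x : Fin n → ℝ) :
    Fin n → Fin d → ℝ :=
  fun j => pdF j F x

/-- The operator `L F = Δ F + Σ_k (g⁻¹ ∂_{x_k} g) ∂_{x_k} F`. -/
def Lop {n d : ℕ} (g : (Fin n → ℝ) → Matrix (Fin d) (Fin d) ℝ)
    (F : (Fin n → ℝ) → Fin d → ℝ) (x : Fin n → ℝ) : Fin d → ℝ :=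
  (∑ k, pdF k (pdF k F) x) + ∑ k, ((g x)⁻¹ * mpd k g x).mulVec (pdF k F x)

/-- `Θ^g(x)` realized as a `dn × dn` matrix acting on `ℝ^{n×d} ≅ M_{d,n}(ℝ)`. -/
def ThetaMat {n d : ℕ} (g : (Fin n → ℝ) → Matrix (Fin d) (Fin d) ℝ)
    (x : Fin n → ℝ) : Matrix (Fin n × Fin d) (Fin n × Fin d) ℝ :=
  Matrix.of fun p q => theta g q.1 p.1 x p.2 q.2

/-- Identification `M_{d,n}(ℝ) → ℝ^{n×d}`. -/
def toVec {n d : ℕ} (U : Fin n → Fin d → ℝ) : Fin n × Fin d → ℝ := fun p => U p.1 p.2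

/-- Identification `ℝ^{n×d} → M_{d,n}(ℝ)`. -/
def ofVec {n d : ℕ} (v : Fin n × Fin d → ℝ) : Fin n → Fin d → ℝ := fun k i => v (k, i)

/-- The block `Θ^g_{0,0}` on `M_{d,n0}(ℝ)`. -/
def Theta00 {n0 n1 d : ℕ} (g : (Fin (n0 + n1) → ℝ) → Matrix (Fin d) (Fin d) ℝ)
    (x : Fin (n0 + n1) → ℝ) (V : Fin n0 → Fin d → ℝ) : Fin n0 → Fin d → ℝ :=
  fun k => ∑ j, (theta g (Fin.castAdd n1 j) (Fin.castAdd n1 k) x).mulVec (V j)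

/-- The mixed block `Θ^g_{0,1} : M_{d,n0}(ℝ) → M_{d,n1}(ℝ)`. -/
def Theta01 {n0 n1 d : ℕ} (g : (Fin (n0 + n1) → ℝ) → Matrix (Fin d) (Fin d) ℝ)
    (x : Fin (n0 + n1) → ℝ) (V : Fin n0 → Fin d → ℝ) : Fin n1 → Fin d → ℝ :=
  fun k => ∑ j, (theta g (Fin.castAdd n1 j) (Fin.natAdd n0 k) x).mulVec (V j)

/-- The block `Θ^g_{1,1}` on `M_{d,n1}(ℝ)`. -/
def Theta11 {n0 n1 d : ℕ} (g : (Fin (n0 + n1) → ℝ) → Matrix (Fin d) (Fin d) ℝ)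
    (x : Fin (n0 + n1) → ℝ) (W : Fin n1 → Fin d → ℝ) : Fin n1 → Fin d → ℝ :=
  fun k => ∑ j, (theta g (Fin.natAdd n0 j) (Fin.natAdd n0 k) x).mulVec (W j)

/-- The block `Θ^g_{1,1}` realized as a `d n1 × d n1` matrix. -/
def Theta11Mat {n0 n1 d : ℕ} (g : (Fin (n0 + n1) → ℝ) → Matrix (Fin d) (Fin d) ℝ)
    (x : Fin (n0 + n1) → ℝ) : Matrix (Fin n1 × Fin d) (Fin n1 × Fin d) ℝ :=
  Matrix.of fun p q => theta g (Fin.natAdd n0 q.1) (Fin.natAdd n0 p.1) x p.2 q.2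

/-- The `dn × dn` matrix `Θ̃^g(x)` with `(j,k)` block `g(x) θ^g_{j,k}(x)`. -/
def tThetaMat {n d : ℕ} (g : (Fin n → ℝ) → Matrix (Fin d) (Fin d) ℝ)
    (x : Fin n → ℝ) : Matrix (Fin n × Fin d) (Fin n × Fin d) ℝ :=
  Matrix.of fun p q => (g x * theta g q.1 p.1 x) p.2 q.2

/-- Hessian matrix of a scalar function on `ℝⁿ`. -/
def Hess {n : ℕ} (φ : (Fin n → ℝ) → ℝ) (y : Fin n → ℝ) : Matrix (Fin n) (Fin n) ℝ :=
  Matrix.of fun j k => fderiv ℝ (fun z => fderiv ℝ φ z (Pi.single k 1)) y (Pi.single j 1)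

/-- Gradient of a scalar function on `ℝⁿ`. -/
def gradV {n : ℕ} (u : (Fin n → ℝ) → ℝ) (y : Fin n → ℝ) : Fin n → ℝ :=
  fun j => fderiv ℝ u y (Pi.single j 1)

section MatrixPrekopaAux

open Filter Topology

lemma mpd_apply {n d : ℕ} (j : Fin n) (g : (Fin n → ℝ) → Matrix (Fin d) (Fin d) ℝ)
    (x : Fin n → ℝ) (i k : Fin d) :
    mpd j g x i k = fderiv ℝ (fun y => g y i k) x (Pi.single j 1) := rfl

lemma matCD_mpd {n d m : ℕ} {g : (Fin n → ℝ) → Matrix (Fin d) (Fin d) ℝ} (hg : MatCD (m + 1) g)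
    (j : Fin n) : MatCD m (mpd j g) := fun i k => by
  have h : ContDiff ℝ m (fderiv ℝ fun y => g y i k) :=
    (hg i k).fderiv_right (by push_cast; exact le_rfl)
  exact h.clm_apply contDiff_const

lemma MatCD.of_le {n d m l : ℕ} {g : (Fin n → ℝ) → Matrix (Fin d) (Fin d) ℝ} (hg : MatCD m g)
    (h : l ≤ m) : MatCD l g := fun i k => (hg i k).of_le (by exact_mod_cast h)

lemma MatCD.continuous {n d m : ℕ} {g : (Fin n → ℝ) → Matrix (Fin d) (Fin d) ℝ} (hg : MatCD m g) :
    Continuous g :=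
  continuous_matrix fun i k => (hg i k).continuous

lemma mpd_comm {n d : ℕ} {g : (Fin n → ℝ) → Matrix (Fin d) (Fin d) ℝ} (hg : MatCD 2 g)
    (j k : Fin n) (x : Fin n → ℝ) : mpd k (mpd j g) x = mpd j (mpd k g) x := by
  ext a b
  have hd : DifferentiableAt ℝ (fderiv ℝ fun y => g y a b) x :=
    ((hg a b).fderiv_right (m := 1) (by norm_num [one_add_one_eq_two])).differentiable
      (by norm_num) x
  have key : ∀ p q : Fin n, mpd q (mpd p g) x a b =
      fderiv ℝ (fderiv ℝ fun y => g y a b) x (Pi.single q 1) (Pi.single p 1) := fun p q => by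
    simp only [mpd_apply]
    rw [fderiv_clm_apply hd (differentiableAt_const _)]
    simp
  rw [key, key]
  exact ((hg a b).contDiffAt.isSymmSndFDerivAt (by simp)).eq _ _

lemma isSymm_mpd {n d : ℕ} {g : (Fin n → ℝ) → Matrix (Fin d) (Fin d) ℝ}
    (hg : ∀ x, (g x).IsSymm) (j : Fin n) (x : Fin n → ℝ) : (mpd j g x).IsSymm := by
  ext a b
  simp only [transpose_apply, mpd_apply, fun y => (hg y).apply a b]

lemma contDiff_matrix_inv {E : Type*} [NormedAddCommGroup E] [NormedSpace ℝ E] {d m : ℕ}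
    {A : E → Matrix (Fin d) (Fin d) ℝ} (hA : ∀ i k, ContDiff ℝ m fun x => A x i k)
    (hu : ∀ x, (A x).det ≠ 0) (i k : Fin d) : ContDiff ℝ m fun x => (A x)⁻¹ i k := by
  have hdet : ∀ B : E → Matrix (Fin d) (Fin d) ℝ, (∀ i k, ContDiff ℝ m fun x => B x i k) →
      ContDiff ℝ m fun x => (B x).det := fun B hB => by
    simp only [det_apply]
    exact ContDiff.sum fun σ _ => (contDiff_prod fun i _ => hB _ _).const_smul _
  simp only [inv_def, Ring.inverse_eq_inv', Matrix.smul_apply, smul_eq_mul, adjugate_apply]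
  refine ((hdet A hA).inv hu).mul (hdet _ fun a b => ?_)
  by_cases h : a = k
  · subst h
    simpa only [updateRow_self] using contDiff_const
  · simpa only [updateRow_ne h] using hA a b

lemma MatCD.inv {n d m : ℕ} {g : (Fin n → ℝ) → Matrix (Fin d) (Fin d) ℝ} (hg : MatCD m g)
    (hp : ∀ x, (g x).PosDef) : MatCD m fun x => (g x)⁻¹ :=
  contDiff_matrix_inv hg fun x => (hp x).det_pos.ne'

lemma Matrix.PosDef.isSymm_real {d : ℕ} {A : Matrix (Fin d) (Fin d) ℝ} (h : A.PosDef) :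
    A.IsSymm := by
  rw [IsSymm, ← conjTranspose_eq_transpose_of_trivial]
  exact h.isHermitian

lemma Matrix.IsSymm.dotProduct_mulVec_comm {d : ℕ} {A : Matrix (Fin d) (Fin d) ℝ}
    (h : A.IsSymm) (u v : Fin d → ℝ) : u ⬝ᵥ A *ᵥ v = v ⬝ᵥ A *ᵥ u := by
  rw [dotProduct_mulVec, ← mulVec_transpose, h.eq, dotProduct_comm]

lemma Matrix.PosDef.mulVec_inv_mulVec {d : ℕ} {A : Matrix (Fin d) (Fin d) ℝ} (h : A.PosDef)
    (v : Fin d → ℝ) : A *ᵥ (A⁻¹ *ᵥ v) = v := by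
  rw [mulVec_mulVec, mul_nonsing_inv _ h.det_pos.ne'.isUnit, one_mulVec]

lemma Matrix.PosDef.inv_mulVec_mulVec {d : ℕ} {A : Matrix (Fin d) (Fin d) ℝ} (h : A.PosDef)
    (v : Fin d → ℝ) : A⁻¹ *ᵥ (A *ᵥ v) = v := by
  rw [mulVec_mulVec, nonsing_inv_mul _ h.det_pos.ne'.isUnit, one_mulVec]

lemma Matrix.PosDef.dotProduct_mulVec_nonneg_real {d : ℕ} {A : Matrix (Fin d) (Fin d) ℝ}
    (h : A.PosDef) (v : Fin d → ℝ) : 0 ≤ v ⬝ᵥ A *ᵥ v := by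
  simpa using h.posSemidef.dotProduct_mulVec_nonneg v

lemma minner_thetaOp {n d : ℕ} {g : (Fin n → ℝ) → Matrix (Fin d) (Fin d) ℝ}
    (hp : ∀ x, (g x).PosDef) (x : Fin n → ℝ) (U : Fin n → Fin d → ℝ) {c : Fin d → ℝ}
    (hc : g x *ᵥ c = ∑ j, mpd j g x *ᵥ U j) :
    minner (g x) (ThetaOp g x U) U =
      (∑ k, ∑ j, U k ⬝ᵥ mpd k (mpd j g) x *ᵥ U j) - c ⬝ᵥ g x *ᵥ c := by
  have hs : ∀ y, (g y).IsSymm := fun y => (hp y).isSymm_real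
  have hc' : c = (g x)⁻¹ *ᵥ ∑ j, mpd j g x *ᵥ U j := by
    rw [← hc, (hp x).inv_mulVec_mulVec]
  have h1 : ∀ k, g x *ᵥ ThetaOp g x U k ⬝ᵥ U k =
      (∑ j, U k ⬝ᵥ mpd k (mpd j g) x *ᵥ U j) - c ⬝ᵥ mpd k g x *ᵥ U k := fun k => by
    rw [(isSymm_mpd hs k x).dotProduct_mulVec_comm, hc', dotProduct_comm]
    simp only [ThetaOp, theta, mulVec_sum, ← mulVec_mulVec, (hp x).mulVec_inv_mulVec, sub_mulVec,
      Finset.sum_sub_distrib, dotProduct_sub, dotProduct_sum]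
  simp only [minner, h1, Finset.sum_sub_distrib]
  rw [hc, dotProduct_sum]

lemma nLogConcave_iff {n d : ℕ} {g : (Fin n → ℝ) → Matrix (Fin d) (Fin d) ℝ}
    (hp : ∀ x, (g x).PosDef) :
    NLogConcave g ↔ ∀ (x : Fin n → ℝ) (U : Fin n → Fin d → ℝ) (c : Fin d → ℝ),
      g x *ᵥ c = ∑ j, mpd j g x *ᵥ U j →
      ∑ k, ∑ j, U k ⬝ᵥ mpd k (mpd j g) x *ᵥ U j ≤ c ⬝ᵥ g x *ᵥ c := by
  refine ⟨fun h x U c hc => ?_, fun h x U => ?_⟩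
  · have := h x U
    rw [minner_thetaOp hp x U hc] at this
    linarith
  · have hc := (hp x).mulVec_inv_mulVec (∑ j, mpd j g x *ᵥ U j)
    rw [minner_thetaOp hp x U hc]
    linarith [h x U _ hc]

lemma MatCD.hasDerivAt_comp {n d m : ℕ} {g : (Fin n → ℝ) → Matrix (Fin d) (Fin d) ℝ}
    (hg : MatCD (m + 1) g) {γ : ℝ → Fin n → ℝ} {s : ℝ} {j : Fin n}
    (hγ : HasDerivAt γ (Pi.single j 1) s) (i k : Fin d) :
    HasDerivAt (fun s => g (γ s) i k) (mpd j g (γ s) i k) s := by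
  have h : HasFDerivAt (fun y => g y i k) (fderiv ℝ (fun y => g y i k) (γ s)) (γ s) :=
    ((hg i k).differentiable (by norm_cast) _).hasFDerivAt
  exact h.comp_hasDerivAt s hγ

lemma hasDerivAt_mulVec {d : ℕ} {A : ℝ → Matrix (Fin d) (Fin d) ℝ}
    {A' : Matrix (Fin d) (Fin d) ℝ} {v : ℝ → Fin d → ℝ} {v' : Fin d → ℝ} {s : ℝ}
    (hA : ∀ i k, HasDerivAt (fun s => A s i k) (A' i k) s) (hv : HasDerivAt v v' s) :
    HasDerivAt (fun s => A s *ᵥ v s) (A' *ᵥ v s + A s *ᵥ v') s := by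
  rw [hasDerivAt_pi] at hv ⊢
  intro i
  have := HasDerivAt.fun_sum (u := Finset.univ) fun k _ => (hA i k).fun_mul (hv k)
  simpa [Matrix.mulVec, dotProduct, Finset.sum_add_distrib] using this

lemma hasDerivAt_dotProduct {d : ℕ} {u v : ℝ → Fin d → ℝ} {u' v' : Fin d → ℝ} {s : ℝ}
    (hu : HasDerivAt u u' s) (hv : HasDerivAt v v' s) :
    HasDerivAt (fun s => u s ⬝ᵥ v s) (u' ⬝ᵥ v s + u s ⬝ᵥ v') s := by
  rw [hasDerivAt_pi] at hu hv
  have := HasDerivAt.fun_sum (u := Finset.univ) fun k _ => (hu k).fun_mul (hv k)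
  simpa [dotProduct, Finset.sum_add_distrib] using this

/-- The one-dimensional inequality behind the marginal theorem, obtained by testing with the
solution `w` of `(G w)' = G c - V` vanishing at both endpoints. -/
lemma intervalIntegral_le_of_nLogConcave {d : ℕ} {a b : ℝ} (hab : a ≤ b)
    {G G₁ G₂ : ℝ → Matrix (Fin d) (Fin d) ℝ} {V V' : ℝ → Fin d → ℝ} {T : ℝ → ℝ} (c : Fin d → ℝ)
    (hp : ∀ s, (G s).PosDef) (hs₁ : ∀ s, (G₁ s).IsSymm)
    (hGc : ∀ i k, ContDiff ℝ 1 fun s => G s i k)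
    (hG : ∀ s i k, HasDerivAt (fun s => G s i k) (G₁ s i k) s)
    (hG₁ : ∀ s i k, HasDerivAt (fun s => G₁ s i k) (G₂ s i k) s)
    (hV : ∀ s, HasDerivAt V (V' s) s) (hT : Continuous T)
    (hc : ∫ s in a..b, (G s *ᵥ c - V s) = 0)
    (hT_le : ∀ s w c', G s *ᵥ c' = V s + G₁ s *ᵥ w →
      T s + 2 * (w ⬝ᵥ V' s) + w ⬝ᵥ G₂ s *ᵥ w ≤ c' ⬝ᵥ G s *ᵥ c') :
    ∫ s in a..b, T s ≤ ∫ s in a..b, c ⬝ᵥ G s *ᵥ c := by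
  have hGcont : Continuous G := continuous_matrix fun i k => (hGc i k).continuous
  have hVcont : Continuous V := continuous_iff_continuousAt.2 fun s => (hV s).continuousAt
  have hI : Continuous fun s => G s *ᵥ c - V s := (hGcont.matrix_mulVec continuous_const).sub hVcont
  have hQ : Continuous fun s => c ⬝ᵥ G s *ᵥ c :=
    continuous_const.dotProduct (hGcont.matrix_mulVec continuous_const)
  set H : ℝ → Fin d → ℝ := fun y => ∫ s in a..y, (G s *ᵥ c - V s) with hH
  have hHd : ∀ y, HasDerivAt H (G y *ᵥ c - V y) y := fun y =>
    intervalIntegral.integral_hasDerivAt_right (hI.intervalIntegrable _ _)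
      (hI.stronglyMeasurableAtFilter _ _) hI.continuousAt
  set w : ℝ → Fin d → ℝ := fun y => (G y)⁻¹ *ᵥ H y with hw
  have hwd : ∀ y, HasDerivAt w (deriv w y) y := fun y =>
    (hasDerivAt_mulVec (A' := Matrix.of fun i k => deriv (fun s => (G s)⁻¹ i k) y)
      (fun i k => ((contDiff_matrix_inv hGc (fun s => (hp s).det_pos.ne') i k).differentiable
        (by norm_num) y).hasDerivAt) (hHd y)).differentiableAt.hasDerivAt
  have hode : ∀ y, G₁ y *ᵥ w y + G y *ᵥ deriv w y = G y *ᵥ c - V y := fun y => by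
    have h1 : (fun s => G s *ᵥ w s) = H := funext fun s => (hp s).mulVec_inv_mulVec _
    have h2 := hasDerivAt_mulVec (hG y) (hwd y)
    rw [h1] at h2
    exact h2.unique (hHd y)
  set Ψ : ℝ → ℝ := fun y => 2 * (w y ⬝ᵥ V y) + w y ⬝ᵥ G₁ y *ᵥ w y with hΨ
  have hΨd : ∀ y, HasDerivAt Ψ (2 * (deriv w y ⬝ᵥ V y + w y ⬝ᵥ V' y) +
      (deriv w y ⬝ᵥ G₁ y *ᵥ w y + w y ⬝ᵥ (G₂ y *ᵥ w y + G₁ y *ᵥ deriv w y))) y := fun y =>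
    ((hasDerivAt_dotProduct (hwd y) (hV y)).const_mul 2).add
      (hasDerivAt_dotProduct (hwd y) (hasDerivAt_mulVec (hG₁ y) (hwd y)))
  have hFd : ∀ y, HasDerivAt (fun y => (∫ s in a..y, (c ⬝ᵥ G s *ᵥ c - T s)) - Ψ y)
      (c ⬝ᵥ G y *ᵥ c - T y - _) y := fun y =>
    (intervalIntegral.integral_hasDerivAt_right ((hQ.sub hT).intervalIntegrable _ _)
      ((hQ.sub hT).stronglyMeasurableAtFilter _ _) (hQ.sub hT).continuousAt).sub (hΨd y)
  have hmono := monotone_of_hasDerivAt_nonneg hFd fun y => by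
    have e : G y *ᵥ (c - deriv w y) = V y + G₁ y *ᵥ w y := by
      have := hode y
      rw [mulVec_sub]
      linear_combination (exp := 1) -this
    have h1 := hT_le y (w y) _ e
    have h2 : deriv w y ⬝ᵥ V y + deriv w y ⬝ᵥ G₁ y *ᵥ w y =
        deriv w y ⬝ᵥ G y *ᵥ (c - deriv w y) := by rw [e, dotProduct_add]
    have h3 := (hp y).dotProduct_mulVec_nonneg_real (deriv w y)
    have h4 := (hs₁ y).dotProduct_mulVec_comm (w y) (deriv w y)
    have h5 := (hp y).isSymm_real.dotProduct_mulVec_comm c (deriv w y)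
    simp only [mulVec_sub, dotProduct_sub, sub_dotProduct, dotProduct_add, Pi.zero_apply]
      at h1 h2 ⊢
    linarith
  have hwa : w a = 0 := by simp [hw, hH]
  have hwb : w b = 0 := by simp [hw, hH, hc]
  have := hmono hab
  simp only [hΨ, hwa, hwb, intervalIntegral.integral_same, zero_dotProduct, mul_zero, add_zero,
    sub_zero] at this
  rw [intervalIntegral.integral_sub (hQ.intervalIntegrable _ _) (hT.intervalIntegrable _ _)] at this
  linarith

section Parametric

variable {E F : Type} [NormedAddCommGroup E] [NormedSpace ℝ E] [ProperSpace E]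
  [NormedAddCommGroup F] [NormedSpace ℝ F]

lemma hasFDerivAt_intervalIntegral_of_contDiff {f : E × ℝ → F} (hf : ContDiff ℝ 1 f) (a b : ℝ)
    (x : E) : HasFDerivAt (fun x => ∫ s in a..b, f (x, s))
      (∫ s in a..b, (fderiv ℝ f (x, s)).comp (ContinuousLinearMap.inl ℝ E ℝ)) x := by
  have hcont : Continuous fun p : E × ℝ =>
      (fderiv ℝ f p).comp (ContinuousLinearMap.inl ℝ E ℝ) :=
    (hf.continuous_fderiv (by norm_num)).clm_comp continuous_const
  obtain ⟨C, hC⟩ := ((isCompact_closedBall x 1).prod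
    (isCompact_uIcc (a := a) (b := b))).exists_bound_of_continuousOn hcont.continuousOn
  refine intervalIntegral.hasFDerivAt_integral_of_dominated_of_fderiv_le
    (F := fun x s => f (x, s)) (bound := fun _ => C)
    (F' := fun x s => (fderiv ℝ f (x, s)).comp (ContinuousLinearMap.inl ℝ E ℝ))
    (Metric.ball_mem_nhds x one_pos) ?_ ?_ ?_ ?_ ?_ ?_
  · exact Filter.Eventually.of_forall fun y =>
      (hf.continuous.comp (by fun_prop : Continuous fun s : ℝ => (y, s))).aestronglyMeasurable
  · exact (hf.continuous.comp
      (by fun_prop : Continuous fun s : ℝ => (x, s))).intervalIntegrable _ _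
  · exact (hcont.comp (by fun_prop : Continuous fun s : ℝ => (x, s))).aestronglyMeasurable
  · exact Filter.Eventually.of_forall fun s hs y hy =>
      hC (y, s) ⟨Metric.ball_subset_closedBall hy, Set.uIoc_subset_uIcc hs⟩
  · exact intervalIntegrable_const
  · exact Filter.Eventually.of_forall fun s _ y _ =>
      ((hf.differentiable (by norm_num) (y, s)).hasFDerivAt).comp y
        (hasFDerivAt_prodMk_left y s)

lemma contDiff_intervalIntegral {f : E × ℝ → F} {m : ℕ} (hf : ContDiff ℝ m f) (a b : ℝ) :
    ContDiff ℝ m fun x => ∫ s in a..b, f (x, s) := by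
  induction m generalizing F with
  | zero =>
    rw [Nat.cast_zero, contDiff_zero] at hf ⊢
    exact intervalIntegral.continuous_parametric_intervalIntegral_of_continuous'
      (f := fun x s => f (x, s)) hf a b
  | succ m ih =>
    have hd := hasFDerivAt_intervalIntegral_of_contDiff (hf.of_le (by norm_cast; omega)) a b
    push_cast at hf ⊢
    rw [contDiff_succ_iff_fderiv]
    refine ⟨fun x => (hd x).differentiableAt, by simp, ?_⟩
    rw [funext fun x => (hd x).fderiv]
    exact ih (f := fun p => (fderiv ℝ f p).comp (ContinuousLinearMap.inl ℝ E ℝ))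
      ((hf.fderiv_right le_rfl).clm_comp contDiff_const)

end Parametric

lemma integrable_mulVec {X : Type*} [MeasurableSpace X] {μ : Measure X} {d : ℕ}
    {A : X → Matrix (Fin d) (Fin d) ℝ} (hA : ∀ i k, Integrable (fun y => A y i k) μ)
    (v : Fin d → ℝ) : Integrable (fun y => A y *ᵥ v) μ :=
  Integrable.of_eval fun i => by
    simpa only [Matrix.mulVec, dotProduct] using
      integrable_finsetSum Finset.univ fun k _ => (hA i k).mul_const (v k)

lemma integral_mulVec {X : Type*} [MeasurableSpace X] {μ : Measure X} {d : ℕ}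
    {A : X → Matrix (Fin d) (Fin d) ℝ} (hA : ∀ i k, Integrable (fun y => A y i k) μ)
    (v : Fin d → ℝ) :
    (Matrix.of fun i k => ∫ y, A y i k ∂μ) *ᵥ v = ∫ y, A y *ᵥ v ∂μ := by
  have hi : ∀ i, Integrable (fun y => (A y *ᵥ v) i) μ := fun i =>
    (integrable_mulVec hA v).eval i
  ext i
  rw [eval_integral hi]
  simp only [Matrix.mulVec, dotProduct, of_apply]
  rw [integral_finsetSum _ fun k _ => (hA i k).mul_const _]
  simp only [integral_mul_const]

lemma dotProduct_integral_mulVec {X : Type*} [MeasurableSpace X] {μ : Measure X} {d : ℕ}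
    {A : X → Matrix (Fin d) (Fin d) ℝ} (hA : ∀ i k, Integrable (fun y => A y i k) μ)
    (u v : Fin d → ℝ) :
    u ⬝ᵥ (Matrix.of fun i k => ∫ y, A y i k ∂μ) *ᵥ v = ∫ y, u ⬝ᵥ A y *ᵥ v ∂μ := by
  have hi : ∀ i, Integrable (fun y => (A y *ᵥ v) i) μ := fun i =>
    (integrable_mulVec hA v).eval i
  rw [integral_mulVec hA]
  simp only [dotProduct]
  rw [integral_finsetSum _ fun k _ => (hi k).const_mul _]
  simp only [eval_integral hi, integral_const_mul]

/-- Integration of a matrix-valued function in its last variable over `[a, b]`. -/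
def slabInt {n d : ℕ} (a b : ℝ) (g : (Fin (n + 1) → ℝ) → Matrix (Fin d) (Fin d) ℝ)
    (x : Fin n → ℝ) : Matrix (Fin d) (Fin d) ℝ :=
  Matrix.of fun i k => ∫ s in a..b, g (Fin.snoc x s) i k

/-- The linear map `(x, s) ↦ (x₁, …, xₙ, s)`. -/
def snocL (n : ℕ) : (Fin n → ℝ) × ℝ →L[ℝ] (Fin (n + 1) → ℝ) :=
  ContinuousLinearMap.pi (Fin.snoc
    (fun i => (ContinuousLinearMap.proj i).comp (ContinuousLinearMap.fst ℝ (Fin n → ℝ) ℝ))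
    (ContinuousLinearMap.snd ℝ (Fin n → ℝ) ℝ))

lemma snocL_apply {n : ℕ} (x : Fin n → ℝ) (s : ℝ) : snocL n (x, s) = Fin.snoc x s := by
  ext i
  refine Fin.lastCases ?_ (fun i => ?_) i <;> simp [snocL]

lemma snocL_single {n : ℕ} (j : Fin n) : snocL n (Pi.single j 1, 0) = Pi.single j.castSucc 1 := by
  rw [snocL_apply]
  ext i
  refine Fin.lastCases ?_ (fun i => ?_) i
  · simp [(Fin.castSucc_lt_last j).ne']
  · simp [Pi.single_apply]

lemma hasDerivAt_snoc {n : ℕ} (x : Fin n → ℝ) (s : ℝ) :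
    HasDerivAt (fun s => (Fin.snoc x s : Fin (n + 1) → ℝ)) (Pi.single (Fin.last n) 1) s := by
  rw [hasDerivAt_pi]
  intro i
  refine Fin.lastCases ?_ (fun i => ?_) i
  · simpa using hasDerivAt_id' s
  · simpa [(Fin.castSucc_lt_last i).ne] using hasDerivAt_const s (x i)

lemma continuous_snoc_right {n : ℕ} (x : Fin n → ℝ) :
    Continuous fun s => (Fin.snoc x s : Fin (n + 1) → ℝ) :=
  continuous_iff_continuousAt.2 fun s => (hasDerivAt_snoc x s).continuousAt

lemma matCD_slabInt {n d m : ℕ} {g : (Fin (n + 1) → ℝ) → Matrix (Fin d) (Fin d) ℝ}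
    (hg : MatCD m g) (a b : ℝ) : MatCD m (slabInt a b g) := fun i k => by
  have := contDiff_intervalIntegral ((hg i k).comp (snocL n).contDiff) a b
  simpa only [Function.comp_def, snocL_apply, slabInt, of_apply] using this

lemma mpd_slabInt {n d m : ℕ} {g : (Fin (n + 1) → ℝ) → Matrix (Fin d) (Fin d) ℝ}
    (hg : MatCD (m + 1) g) (a b : ℝ) (j : Fin n) :
    mpd j (slabInt a b g) = slabInt a b (mpd j.castSucc g) := by
  ext x i k
  have h1 : ContDiff ℝ 1 fun y => g y i k := (hg i k).of_le (by norm_cast; omega)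
  have h2 : ContDiff ℝ 1 ((fun y => g y i k) ∘ snocL n) := h1.comp (snocL n).contDiff
  have h := hasFDerivAt_intervalIntegral_of_contDiff h2 a b x
  have hcont : Continuous fun s : ℝ => (fderiv ℝ ((fun y => g y i k) ∘ snocL n) (x, s)).comp
      (ContinuousLinearMap.inl ℝ (Fin n → ℝ) ℝ) :=
    ((h2.continuous_fderiv (by norm_num)).comp (by fun_prop)).clm_comp continuous_const
  simp only [Function.comp_apply, snocL_apply] at h
  rw [mpd_apply]
  simp only [slabInt, of_apply]
  rw [h.fderiv, ContinuousLinearMap.intervalIntegral_apply (hcont.intervalIntegrable _ _)]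
  refine intervalIntegral.integral_congr fun s _ => ?_
  have h3 := ((h1.differentiable (by norm_num) (snocL n (x, s))).hasFDerivAt.comp (x, s)
    (snocL n).hasFDerivAt).fderiv
  simp only [h3, mpd_apply, ContinuousLinearMap.comp_apply, ContinuousLinearMap.inl_apply,
    snocL_single]
  rw [snocL_apply]

lemma slabInt_eq {n d : ℕ} {a b : ℝ} (hab : a ≤ b)
    (g : (Fin (n + 1) → ℝ) → Matrix (Fin d) (Fin d) ℝ) (x : Fin n → ℝ) :
    slabInt a b g x = Matrix.of fun i k => ∫ s in Set.Ioc a b, g (Fin.snoc x s) i k := by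
  simp only [slabInt, intervalIntegral.integral_of_le hab]

lemma integrable_slab {n d : ℕ} {g : (Fin (n + 1) → ℝ) → Matrix (Fin d) (Fin d) ℝ}
    (hg : Continuous g) (a b : ℝ) (x : Fin n → ℝ) (i k : Fin d) :
    Integrable (fun s => g (Fin.snoc x s) i k) (volume.restrict (Set.Ioc a b)) :=
  ((hg.comp (continuous_snoc_right x)).matrix_elem i k).integrableOn_Ioc

lemma slabInt_mulVec {n d : ℕ} {a b : ℝ} (hab : a ≤ b)
    {g : (Fin (n + 1) → ℝ) → Matrix (Fin d) (Fin d) ℝ} (hg : Continuous g) (x : Fin n → ℝ)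
    (v : Fin d → ℝ) :
    slabInt a b g x *ᵥ v = ∫ s in a..b, g (Fin.snoc x s) *ᵥ v := by
  rw [slabInt_eq hab, integral_mulVec (integrable_slab hg a b x),
    intervalIntegral.integral_of_le hab]

lemma dotProduct_slabInt_mulVec {n d : ℕ} {a b : ℝ} (hab : a ≤ b)
    {g : (Fin (n + 1) → ℝ) → Matrix (Fin d) (Fin d) ℝ} (hg : Continuous g) (x : Fin n → ℝ)
    (u v : Fin d → ℝ) :
    u ⬝ᵥ slabInt a b g x *ᵥ v = ∫ s in a..b, u ⬝ᵥ g (Fin.snoc x s) *ᵥ v := by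
  rw [slabInt_eq hab, dotProduct_integral_mulVec (integrable_slab hg a b x),
    intervalIntegral.integral_of_le hab]

lemma posDef_of_pos {d : ℕ} {A : Matrix (Fin d) (Fin d) ℝ} (hs : A.IsSymm)
    (h : ∀ v, v ≠ 0 → 0 < v ⬝ᵥ A *ᵥ v) : A.PosDef :=
  PosDef.of_dotProduct_mulVec_pos
    (by rw [IsHermitian, conjTranspose_eq_transpose_of_trivial]; exact hs)
    fun v hv => by simpa using h v hv

lemma posDef_slabInt {n d : ℕ} {a b : ℝ} (hab : a < b)
    {g : (Fin (n + 1) → ℝ) → Matrix (Fin d) (Fin d) ℝ} (hg : Continuous g)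
    (hp : ∀ x, (g x).PosDef) (x : Fin n → ℝ) : (slabInt a b g x).PosDef := by
  refine posDef_of_pos ?_ fun v hv => ?_
  · ext i k
    simp only [slabInt, transpose_apply, of_apply, fun y => (hp y).isSymm_real.apply i k]
  · rw [dotProduct_slabInt_mulVec hab.le hg]
    refine intervalIntegral.intervalIntegral_pos_of_pos ?_ (fun s => ?_) hab
    · exact (continuous_const.dotProduct ((hg.comp (continuous_snoc_right x)).matrix_mulVec
        continuous_const)).intervalIntegrable _ _
    · simpa using (hp (Fin.snoc x s)).dotProduct_mulVec_pos hv

lemma nLogConcave_slabInt {n d : ℕ} {a b : ℝ} (hab : a < b)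
    {g : (Fin (n + 1) → ℝ) → Matrix (Fin d) (Fin d) ℝ} (hg : MatCD 2 g)
    (hp : ∀ x, (g x).PosDef) (hlc : NLogConcave g) : NLogConcave (slabInt a b g) := by
  have hs : ∀ x, (g x).IsSymm := fun x => (hp x).isSymm_real
  have hg₁ : ∀ j, MatCD 1 (mpd j g) := fun j => matCD_mpd hg j
  have hg₂ : ∀ j k, MatCD 0 (mpd k (mpd j g)) := fun j k => matCD_mpd (hg₁ j) k
  have hcomp : ∀ {A : (Fin (n + 1) → ℝ) → Matrix (Fin d) (Fin d) ℝ}, Continuous A →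
      ∀ (x : Fin n → ℝ) (v : Fin d → ℝ), Continuous fun s => A (Fin.snoc x s) *ᵥ v :=
    fun hA x v => (hA.comp (continuous_snoc_right x)).matrix_mulVec continuous_const
  rw [nLogConcave_iff (posDef_slabInt hab hg.continuous hp)]
  rw [nLogConcave_iff hp] at hlc
  intro x U c hc
  have key := intervalIntegral_le_of_nLogConcave hab.le
    (G := fun s => g (Fin.snoc x s))
    (G₁ := fun s => mpd (Fin.last n) g (Fin.snoc x s))
    (G₂ := fun s => mpd (Fin.last n) (mpd (Fin.last n) g) (Fin.snoc x s))
    (V := fun s => ∑ j, mpd (Fin.castSucc j) g (Fin.snoc x s) *ᵥ U j)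
    (V' := fun s => ∑ j, mpd (Fin.last n) (mpd (Fin.castSucc j) g) (Fin.snoc x s) *ᵥ U j)
    (T := fun s => ∑ k, ∑ j,
      U k ⬝ᵥ mpd (Fin.castSucc k) (mpd (Fin.castSucc j) g) (Fin.snoc x s) *ᵥ U j) c
    (fun s => hp _) (fun s => isSymm_mpd hs _ _)
    (fun i k => ?_)
    (fun s i k => hg.hasDerivAt_comp (m := 1) (hasDerivAt_snoc x s) i k)
    (fun s i k => (hg₁ _).hasDerivAt_comp (m := 0) (hasDerivAt_snoc x s) i k)
    (fun s => ?_) ?_ ?_ (fun s w c' hc' => ?_)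
  · rw [dotProduct_slabInt_mulVec hab.le hg.continuous]
    refine le_of_eq_of_le ?_ key
    have hi : ∀ k j, Continuous fun s => U k ⬝ᵥ mpd (Fin.castSucc k) (mpd (Fin.castSucc j) g)
        (Fin.snoc x s) *ᵥ U j := fun k j =>
      continuous_const.dotProduct (hcomp (hg₂ _ _).continuous x _)
    rw [intervalIntegral.integral_finsetSum fun k _ =>
      (continuous_finsetSum _ fun j _ => hi k j).intervalIntegrable _ _]
    refine Finset.sum_congr rfl fun k _ => ?_
    rw [intervalIntegral.integral_finsetSum fun j _ => (hi k j).intervalIntegrable _ _]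
    refine Finset.sum_congr rfl fun j _ => ?_
    rw [mpd_slabInt hg (m := 1), mpd_slabInt (hg₁ _) (m := 0),
      dotProduct_slabInt_mulVec hab.le (hg₂ _ _).continuous]
  · have := ((hg i k).of_le (by norm_num : (1 : WithTop ℕ∞) ≤ (2 : ℕ))).comp
      ((snocL n).contDiff.comp (contDiff_prodMk_right x))
    simpa only [Function.comp_def, snocL_apply] using this
  · refine HasDerivAt.fun_sum fun j _ => ?_
    simpa using hasDerivAt_mulVec (v := fun _ => U j)
      (fun i k => (hg₁ (Fin.castSucc j)).hasDerivAt_comp (m := 0) (hasDerivAt_snoc x s) i k)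
      (hasDerivAt_const s (U j))
  · exact continuous_finsetSum _ fun k _ => continuous_finsetSum _ fun j _ =>
      continuous_const.dotProduct (hcomp (hg₂ _ _).continuous x _)
  · rw [intervalIntegral.integral_sub ((hcomp hg.continuous x c).intervalIntegrable _ _)
      ((continuous_finsetSum _ fun j _ =>
        hcomp (hg₁ _).continuous x _).intervalIntegrable _ _),
      intervalIntegral.integral_finsetSum fun j _ =>
        (hcomp (hg₁ _).continuous x _).intervalIntegrable _ _,
      ← slabInt_mulVec hab.le hg.continuous, hc, sub_eq_zero]
    refine Finset.sum_congr rfl fun j _ => ?_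
    rw [mpd_slabInt hg (m := 1), slabInt_mulVec hab.le (hg₁ _).continuous]
  · have h := hlc (Fin.snoc x s) (Fin.snoc U w) c' (by
      rw [Fin.sum_univ_castSucc]
      simpa using hc')
    simp only [Fin.sum_univ_castSucc, Fin.snoc_castSucc, Fin.snoc_last,
      Finset.sum_add_distrib] at h
    have e : ∀ k, U k ⬝ᵥ mpd (Fin.castSucc k) (mpd (Fin.last n) g) (Fin.snoc x s) *ᵥ w =
        w ⬝ᵥ mpd (Fin.last n) (mpd (Fin.castSucc k) g) (Fin.snoc x s) *ᵥ U k := fun k => by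
      rw [mpd_comm hg, (isSymm_mpd (isSymm_mpd hs _) _ _).dotProduct_mulVec_comm]
    simp only [e] at h
    simp only [dotProduct_sum]
    linarith

/-- Integration of a matrix-valued function over `(-R, R]` in each of its last `n₁` variables. -/
def boxInt {n₀ d : ℕ} (R : ℝ) : (n₁ : ℕ) → ((Fin (n₀ + n₁) → ℝ) → Matrix (Fin d) (Fin d) ℝ) →
    (Fin n₀ → ℝ) → Matrix (Fin d) (Fin d) ℝ
  | 0, g => g
  | n₁ + 1, g => boxInt R n₁ (slabInt (-R) R g)

lemma boxInt_regular {n₀ d n₁ : ℕ} {R : ℝ} (hR : 0 < R)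
    {g : (Fin (n₀ + n₁) → ℝ) → Matrix (Fin d) (Fin d) ℝ} (hg : MatCD 2 g)
    (hp : ∀ x, (g x).PosDef) (hlc : NLogConcave g) :
    MatCD 2 (boxInt R n₁ g) ∧ (∀ x, (boxInt R n₁ g x).PosDef) ∧ NLogConcave (boxInt R n₁ g) := by
  induction n₁ with
  | zero => exact ⟨hg, hp, hlc⟩
  | succ n₁ ih =>
    have h : -R < R := by linarith
    exact ih (matCD_slabInt hg _ _) (posDef_slabInt h hg.continuous hp)
      (nLogConcave_slabInt h hg hp hlc)

/-- The half-open cube `(-R, R]ⁿ`. -/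
def cube (n : ℕ) (R : ℝ) : Set (Fin n → ℝ) := Set.univ.pi fun _ => Set.Ioc (-R) R

lemma measurableSet_cube (n : ℕ) (R : ℝ) : MeasurableSet (cube n R) :=
  MeasurableSet.univ_pi fun _ => measurableSet_Ioc

lemma cube_mono (n : ℕ) : Monotone (cube n) := fun _ _ h =>
  Set.pi_mono fun _ _ => Set.Ioc_subset_Ioc (neg_le_neg h) h

lemma iUnion_cube (n : ℕ) : ⋃ m : ℕ, cube n ((m : ℝ) + 1) = Set.univ := by
  refine Set.eq_univ_of_forall fun y => ?_
  obtain ⟨m, hm⟩ := exists_nat_ge ‖y‖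
  refine Set.mem_iUnion.2 ⟨m, fun i _ => ?_⟩
  have h := abs_le.1 ((norm_le_pi_norm y i).trans hm)
  exact ⟨by linarith, by linarith⟩

lemma continuous_append_right {n₀ n₁ : ℕ} (t : Fin n₀ → ℝ) :
    Continuous fun y : Fin n₁ → ℝ => Fin.append t y := by
  refine continuous_pi fun i => ?_
  refine Fin.addCases (fun i => ?_) (fun i => ?_) i
  · simpa using continuous_const
  · simpa using continuous_apply i

lemma boxInt_apply {n₀ d n₁ : ℕ} {R : ℝ} (hR : 0 ≤ R)
    {g : (Fin (n₀ + n₁) → ℝ) → Matrix (Fin d) (Fin d) ℝ} (hg : MatCD 0 g) (t : Fin n₀ → ℝ)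
    (i k : Fin d) :
    boxInt R n₁ g t i k = ∫ y in cube n₁ R, g (Fin.append t y) i k := by
  induction n₁ with
  | zero =>
    have h0 : cube 0 R = Set.univ := by simp [cube, Set.pi]
    rw [h0, Measure.restrict_univ, volume_pi, Measure.pi_of_empty _ Fin.elim0, integral_dirac]
    simp [boxInt]
  | succ n₁ ih =>
    rw [boxInt, ih (matCD_slabInt hg _ _)]
    set F : ℝ × (Fin n₁ → ℝ) → ℝ := fun p =>
      g (Fin.snoc (α := fun _ => ℝ) (Fin.append t p.2) p.1) i k with hF
    have hFc : Continuous F := by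
      have h1 : Continuous fun p : ℝ × (Fin n₁ → ℝ) => snocL (n₀ + n₁) (Fin.append t p.2, p.1) :=
        (snocL _).continuous.comp
          (((continuous_append_right t).comp continuous_snd).prodMk continuous_fst)
      simp only [snocL_apply] at h1
      exact (hg.continuous.comp h1).matrix_elem i k
    have hFi : IntegrableOn F (Set.Ioc (-R) R ×ˢ cube n₁ R) (volume.prod volume) := by
      refine IntegrableOn.mono_set (hFc.continuousOn.integrableOn_compact
        (isCompact_Icc.prod (isCompact_univ_pi fun _ => isCompact_Icc)))
        (Set.prod_mono Set.Ioc_subset_Icc_self (Set.pi_mono fun _ _ => Set.Ioc_subset_Icc_self))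
    have hpre : MeasurableEquiv.piFinSuccAbove (fun _ => ℝ) (Fin.last n₁) ⁻¹'
        (Set.Ioc (-R) R ×ˢ cube n₁ R) = cube (n₁ + 1) R := by
      ext y
      simp [cube, Fin.forall_fin_succ', and_comm, MeasurableEquiv.piFinSuccAbove,
        Fin.insertNthEquiv, Fin.init]
    have hmp := (volume_preserving_piFinSuccAbove (fun _ => ℝ)
      (Fin.last n₁)).setIntegral_preimage_emb (MeasurableEquiv.measurableEmbedding _) F (Set.Ioc (-R) R ×ˢ cube n₁ R)
    rw [hpre] at hmp
    have hval : ∀ y : Fin (n₁ + 1) → ℝ,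
        F (MeasurableEquiv.piFinSuccAbove (fun _ => ℝ) (Fin.last n₁) y) =
          g (Fin.append t y) i k := fun y => by
      have h : F (MeasurableEquiv.piFinSuccAbove (fun _ => ℝ) (Fin.last n₁) y) =
          F (y (Fin.last n₁), Fin.init y) := by
        simp [MeasurableEquiv.piFinSuccAbove, Fin.insertNthEquiv]
      rw [h]
      simp only [hF, ← Fin.append_snoc, Fin.snoc_init_self]
    simp only [hval] at hmp
    rw [hmp, Measure.volume_eq_prod, ← Measure.prod_restrict]
    rw [IntegrableOn, ← Measure.prod_restrict] at hFi
    rw [integral_prod_symm _ hFi]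
    refine integral_congr_ae (Filter.Eventually.of_forall fun y => ?_)
    simp only [slabInt, of_apply, hF]
    rw [intervalIntegral.integral_of_le (by linarith)]

lemma Matrix.PosDef.inv_quadForm_le {d : ℕ} {A B : Matrix (Fin d) (Fin d) ℝ} (hA : A.PosDef)
    (hB : B.PosDef) (h : ∀ v, v ⬝ᵥ A *ᵥ v ≤ v ⬝ᵥ B *ᵥ v) (v : Fin d → ℝ) :
    v ⬝ᵥ B⁻¹ *ᵥ v ≤ v ⬝ᵥ A⁻¹ *ᵥ v := by
  have h1 := hA.dotProduct_mulVec_nonneg_real (A⁻¹ *ᵥ v - B⁻¹ *ᵥ v)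
  have h2 := h (B⁻¹ *ᵥ v)
  have h3 := hA.isSymm_real.dotProduct_mulVec_comm (A⁻¹ *ᵥ v) (B⁻¹ *ᵥ v)
  rw [hB.mulVec_inv_mulVec] at h2
  simp only [mulVec_sub, dotProduct_sub, sub_dotProduct, hA.mulVec_inv_mulVec] at h1 h3
  have h4 := dotProduct_comm (A⁻¹ *ᵥ v) v
  have h5 := dotProduct_comm (B⁻¹ *ᵥ v) v
  linarith

lemma Matrix.IsSymm.apply_eq_quadForm {d : ℕ} {A : Matrix (Fin d) (Fin d) ℝ} (hA : A.IsSymm)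
    (i k : Fin d) :
    A i k = ((Pi.single i 1 + Pi.single k 1) ⬝ᵥ A *ᵥ (Pi.single i 1 + Pi.single k 1) -
      Pi.single i 1 ⬝ᵥ A *ᵥ Pi.single i 1 - Pi.single k 1 ⬝ᵥ A *ᵥ Pi.single k 1) / 2 := by
  have := hA.apply i k
  simp only [mulVec_add, dotProduct_add, add_dotProduct, mulVec_single_one, single_one_dotProduct,
    col_apply, this]
  ring

section Line

variable {n d : ℕ} {A : (Fin n → ℝ) → Matrix (Fin d) (Fin d) ℝ}

lemma hasDerivAt_line (x : Fin n → ℝ) (j : Fin n) (s : ℝ) :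
    HasDerivAt (fun s : ℝ => x + s • (Pi.single j 1 : Fin n → ℝ)) (Pi.single j 1) s := by
  simpa using ((hasDerivAt_id' s).smul_const (Pi.single j 1 : Fin n → ℝ)).const_add x

lemma hasDerivAt_mulVec_line (hA : MatCD 1 A) (x : Fin n → ℝ) (j : Fin n) (v : Fin d → ℝ) (s : ℝ) :
    HasDerivAt (fun s : ℝ => A (x + s • Pi.single j 1) *ᵥ v)
      (mpd j A (x + s • Pi.single j 1) *ᵥ v) s := by
  simpa using hasDerivAt_mulVec (v := fun _ => v)
    (fun i k => hA.hasDerivAt_comp (m := 0) (hasDerivAt_line x j s) i k) (hasDerivAt_const s v)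

lemma hasDerivAt_inv_quadForm_line (hA : MatCD 2 A) (hp : ∀ x, (A x).PosDef) (x : Fin n → ℝ)
    (j : Fin n) (v : Fin d → ℝ) (s : ℝ) :
    HasDerivAt (fun s : ℝ => v ⬝ᵥ (A (x + s • Pi.single j 1))⁻¹ *ᵥ v)
      (v ⬝ᵥ mpd j (fun y => (A y)⁻¹) (x + s • Pi.single j 1) *ᵥ v) s := by
  simpa using hasDerivAt_dotProduct (hasDerivAt_const s v)
    (hasDerivAt_mulVec_line ((hA.inv hp).of_le one_le_two) x j v s)

lemma mulVec_mpd_inv (hA : MatCD 2 A) (hp : ∀ x, (A x).PosDef) (x : Fin n → ℝ) (j : Fin n)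
    (v : Fin d → ℝ) :
    A x *ᵥ mpd j (fun y => (A y)⁻¹) x *ᵥ v = -(mpd j A x *ᵥ (A x)⁻¹ *ᵥ v) := by
  have h := hasDerivAt_mulVec
    (fun i k => (hA.of_le one_le_two).hasDerivAt_comp (m := 0) (hasDerivAt_line x j 0) i k)
    (hasDerivAt_mulVec_line ((hA.inv hp).of_le one_le_two) x j v 0)
  simp only [(hp _).mulVec_inv_mulVec] at h
  have := h.unique (hasDerivAt_const _ _)
  simp only [zero_smul, add_zero] at this
  exact eq_neg_of_add_eq_zero_right this

lemma mpd_mulVec_eq (hA : MatCD 2 A) (hp : ∀ x, (A x).PosDef) (x : Fin n → ℝ) (j : Fin n)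
    (u : Fin d → ℝ) :
    mpd j A x *ᵥ u = A x *ᵥ -(mpd j (fun y => (A y)⁻¹) x *ᵥ A x *ᵥ u) := by
  rw [mulVec_neg, mulVec_mpd_inv hA hp, (hp x).inv_mulVec_mulVec, neg_neg]

lemma convexOn_inv_quadForm_line (hA : MatCD 2 A) (hp : ∀ x, (A x).PosDef) (hlc : NLogConcave A)
    (x : Fin n → ℝ) (j : Fin n) (v : Fin d → ℝ) :
    ConvexOn ℝ Set.univ fun s : ℝ => v ⬝ᵥ (A (x + s • Pi.single j 1))⁻¹ *ᵥ v := by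
  have hB := hA.inv hp
  have hB₁ : MatCD 1 (mpd j fun y => (A y)⁻¹) := matCD_mpd hB j
  have hA₁ : MatCD 1 (mpd j A) := matCD_mpd hA j
  refine convexOn_of_hasDerivWithinAt2_nonneg convex_univ
    (fun s _ => (hasDerivAt_inv_quadForm_line hA hp x j v s).continuousAt.continuousWithinAt)
    (fun s _ => (hasDerivAt_inv_quadForm_line hA hp x j v s).hasDerivWithinAt)
    (fun s _ => (hasDerivAt_dotProduct (hasDerivAt_const s v)
      (hasDerivAt_mulVec_line hB₁ x j v s)).hasDerivWithinAt) fun s _ => ?_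
  rw [nLogConcave_iff hp] at hlc
  have e1 : ∀ s : ℝ, mpd j A (x + s • Pi.single j 1) *ᵥ (A (x + s • Pi.single j 1))⁻¹ *ᵥ v +
      A (x + s • Pi.single j 1) *ᵥ mpd j (fun y => (A y)⁻¹) (x + s • Pi.single j 1) *ᵥ v = 0 :=
    fun s => by rw [mulVec_mpd_inv hA hp, add_neg_cancel]
  have e2 := ((hasDerivAt_mulVec
    (fun i k => hA₁.hasDerivAt_comp (m := 0) (hasDerivAt_line x j s) i k)
    (hasDerivAt_mulVec_line (hB.of_le one_le_two) x j v s)).add (hasDerivAt_mulVec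
    (fun i k => (hA.of_le one_le_two).hasDerivAt_comp (m := 0) (hasDerivAt_line x j s) i k)
    (hasDerivAt_mulVec_line hB₁ x j v s))).congr_of_eventuallyEq
      (Eventually.of_forall fun s => (e1 s).symm) |>.unique (hasDerivAt_const s 0)
  replace e1 := e1 s
  set y := x + s • (Pi.single j 1 : Fin n → ℝ)
  have hs := (hp y).isSymm_real
  have h := hlc y (Pi.single j ((A y)⁻¹ *ᵥ v)) (-(mpd j (fun y => (A y)⁻¹) y *ᵥ v)) (by
    rw [Finset.sum_eq_single j (fun b _ hb => by simp [hb]) (by simp), Pi.single_eq_same,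
      mulVec_neg]
    exact (eq_neg_of_add_eq_zero_left e1).symm)
  rw [Finset.sum_eq_single j (fun b _ hb => by simp [hb]) (by simp),
    Finset.sum_eq_single j (fun b _ hb => by simp [hb]) (by simp), Pi.single_eq_same] at h
  have h0 := (hp y).dotProduct_mulVec_nonneg_real (mpd j (fun y => (A y)⁻¹) y *ᵥ v)
  have e3 := congrArg (fun w => (A y)⁻¹ *ᵥ v ⬝ᵥ w) e2
  have e4 := congrArg (fun w => mpd j (fun y => (A y)⁻¹) y *ᵥ v ⬝ᵥ w) e1
  have e5 := (isSymm_mpd (fun y => (hp y).isSymm_real) j y).dotProduct_mulVec_comm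
    ((A y)⁻¹ *ᵥ v) (mpd j (fun y => (A y)⁻¹) y *ᵥ v)
  have e6 := hs.dotProduct_mulVec_comm ((A y)⁻¹ *ᵥ v)
    (mpd j (mpd j fun y => (A y)⁻¹) y *ᵥ v)
  rw [(hp y).mulVec_inv_mulVec, dotProduct_comm _ v] at e6
  simp only [dotProduct_add, dotProduct_zero, mulVec_neg, dotProduct_neg, neg_dotProduct] at e3 e4 h
  simp only [zero_dotProduct, zero_add]
  linarith

end Line

lemma tendsto_deriv_of_convexOn {f : ℕ → ℝ → ℝ} {f' : ℕ → ℝ} {F : ℝ → ℝ} {F' x : ℝ}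
    (hc : ∀ m, ConvexOn ℝ Set.univ (f m)) (hf : ∀ m, HasDerivAt (f m) (f' m) x)
    (hF : HasDerivAt F F' x) (hlim : ∀ s, Tendsto (fun m => f m s) atTop (𝓝 (F s))) :
    Tendsto f' atTop (𝓝 F') := by
  have hslope : ∀ s, Tendsto (fun m => slope (f m) x s) atTop (𝓝 (slope F x s)) := fun s => by
    simp only [slope_def_field]
    exact ((hlim s).sub (hlim x)).div_const _
  have hs := hasDerivAt_iff_tendsto_slope.1 hF
  rw [tendsto_order]
  refine ⟨fun a ha => ?_, fun a ha => ?_⟩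
  · have h1 : ∀ᶠ s in 𝓝[<] x, a < slope F x s :=
      (hs.mono_left (nhdsWithin_mono _ fun y hy => ne_of_lt hy)).eventually_const_lt ha
    obtain ⟨s, h2, h3⟩ := (h1.and self_mem_nhdsWithin).exists
    filter_upwards [(hslope s).eventually_const_lt h2] with m hm
    rw [slope_comm] at hm
    exact hm.trans_le ((hc m).slope_le_of_hasDerivAt (Set.mem_univ _) (Set.mem_univ _) h3 (hf m))
  · have h1 : ∀ᶠ s in 𝓝[>] x, slope F x s < a :=
      (hs.mono_left (nhdsWithin_mono _ fun y hy => ne_of_gt hy)).eventually_lt_const ha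
    obtain ⟨s, h2, h3⟩ := (h1.and self_mem_nhdsWithin).exists
    filter_upwards [(hslope s).eventually_lt_const h2] with m hm
    exact ((hc m).le_slope_of_hasDerivAt (Set.mem_univ _) (Set.mem_univ _) h3 (hf m)).trans_lt hm

lemma abs_deriv_le_of_convexOn {f : ℝ → ℝ} {f' : ℝ} (hc : ConvexOn ℝ Set.univ f)
    (hf : HasDerivAt f f' 0) (h0 : ∀ s, 0 ≤ f s) : |f'| ≤ f 1 + f (-1) := by
  have h1 := hc.le_slope_of_hasDerivAt (Set.mem_univ _) (Set.mem_univ _) one_pos hf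
  have h2 := hc.slope_le_of_hasDerivAt (Set.mem_univ (-1)) (Set.mem_univ _) (by norm_num) hf
  simp only [slope_def_field] at h1 h2
  rw [abs_le]
  constructor <;> linarith [h0 0, h0 1, h0 (-1)]

lemma tendsto_integral_mul_of_locallyBounded {n : ℕ} {ψ : (Fin n → ℝ) → ℝ} (hψ : Continuous ψ)
    (hψc : HasCompactSupport ψ) {f : ℕ → (Fin n → ℝ) → ℝ} {F : (Fin n → ℝ) → ℝ}
    (hf : ∀ m, Continuous (f m)) (hlim : ∀ x, Tendsto (fun m => f m x) atTop (𝓝 (F x)))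
    (hb : ∀ K, IsCompact K → ∃ C, ∀ m, ∀ x ∈ K, |f m x| ≤ C) :
    Tendsto (fun m => ∫ x, ψ x * f m x) atTop (𝓝 (∫ x, ψ x * F x)) := by
  obtain ⟨C, hC⟩ := hb _ hψc
  refine tendsto_integral_of_dominated_convergence (fun x => |ψ x| * C)
    (fun m => (hψ.mul (hf m)).aestronglyMeasurable) ?_ (fun m => Eventually.of_forall fun x => ?_)
    (Eventually.of_forall fun x => (hlim x).const_mul _)
  · exact (hψ.abs.integrable_of_hasCompactSupport hψc.norm).mul_const C
  · rw [norm_mul, Real.norm_eq_abs, Real.norm_eq_abs]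
    by_cases hx : x ∈ tsupport ψ
    · exact mul_le_mul_of_nonneg_left (hC m x hx) (abs_nonneg _)
    · simp [image_eq_zero_of_notMem_tsupport hx]

lemma integral_mul_mpd_mpd {n d : ℕ} {A : (Fin n → ℝ) → Matrix (Fin d) (Fin d) ℝ} (hA : MatCD 2 A)
    {φ : (Fin n → ℝ) → ℝ} (hφ : ContDiff ℝ 2 φ) (hφc : HasCompactSupport φ) (j k : Fin n)
    (a b : Fin d) :
    ∫ x, φ x * mpd k (mpd j A) x a b =
      ∫ x, fderiv ℝ (fun y => fderiv ℝ φ y (Pi.single k 1)) x (Pi.single j 1) * A x a b := by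
  have hA₁ : MatCD 1 (mpd j A) := matCD_mpd hA j
  have hφ₁ : ContDiff ℝ 1 fun y => fderiv ℝ φ y (Pi.single k 1) :=
    (hφ.fderiv_right (m := 1) (by norm_num [one_add_one_eq_two])).clm_apply contDiff_const
  have hc₁ : HasCompactSupport fun y => fderiv ℝ φ y (Pi.single k 1) := hφc.fderiv_apply _ _
  have hφ₂ : Continuous fun x =>
      fderiv ℝ (fun y => fderiv ℝ φ y (Pi.single k 1)) x (Pi.single j 1) :=
    (hφ₁.continuous_fderiv (by norm_num)).clm_apply continuous_const
  have hc₂ := hc₁.fderiv_apply ℝ (Pi.single j 1)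
  have cA := hA.continuous.matrix_elem a b
  have cA₁ := hA₁.continuous.matrix_elem a b
  have cA₂ := (matCD_mpd (m := 0) hA₁ k).continuous.matrix_elem a b
  have s1 := integral_mul_fderiv_eq_neg_fderiv_mul_of_integrable (μ := volume) (v := Pi.single k 1)
    (f := φ) (g := fun x => mpd j A x a b)
    ((hφ₁.continuous.mul cA₁).integrable_of_hasCompactSupport hc₁.mul_right)
    ((hφ.continuous.mul cA₂).integrable_of_hasCompactSupport hφc.mul_right)
    ((hφ.continuous.mul cA₁).integrable_of_hasCompactSupport hφc.mul_right)
    (fun x _ => hφ.differentiable (by norm_num) x)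
    (fun x _ => (hA₁ a b).differentiable (by norm_num) x)
  have s2 := integral_mul_fderiv_eq_neg_fderiv_mul_of_integrable (μ := volume) (v := Pi.single j 1)
    (f := fun y => fderiv ℝ φ y (Pi.single k 1)) (g := fun x => A x a b)
    ((hφ₂.mul cA).integrable_of_hasCompactSupport hc₂.mul_right)
    ((hφ₁.continuous.mul cA₁).integrable_of_hasCompactSupport hc₁.mul_right)
    ((hφ₁.continuous.mul cA).integrable_of_hasCompactSupport hc₁.mul_right)
    (fun x _ => hφ₁.differentiable (by norm_num) x)
    (fun x _ => (hA a b).differentiable (by norm_num) x)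
  simp only [← mpd_apply] at s1 s2
  rw [s1, s2, neg_neg]

lemma nonpos_of_integral_bump_nonpos {n : ℕ} {h : (Fin n → ℝ) → ℝ} (hh : Continuous h)
    (hint : ∀ φ : (Fin n → ℝ) → ℝ, ContDiff ℝ 2 φ → HasCompactSupport φ → (∀ x, 0 ≤ φ x) →
      ∫ x, φ x * h x ≤ 0) (x : Fin n → ℝ) : h x ≤ 0 := by
  by_contra! hx
  obtain ⟨r, hr, hball⟩ := Metric.mem_nhds_iff.1 (hh.continuousAt.eventually_const_lt hx)
  let φ : ContDiffBump x := ⟨r / 2, r, by linarith, by linarith⟩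
  refine (hint φ φ.contDiff φ.hasCompactSupport fun _ => φ.nonneg).not_gt ?_
  refine (φ.continuous.mul hh).integral_pos_of_hasCompactSupport_nonneg_nonzero
    φ.hasCompactSupport.mul_right (fun y => ?_) (x := x) ?_
  · by_cases hy : y ∈ Metric.ball x r
    · exact mul_nonneg φ.nonneg (hball hy).le
    · have : φ y = 0 := φ.zero_of_le_dist (by simpa using hy)
      simp [this]
  · rw [φ.one_of_mem_closedBall (Metric.mem_closedBall_self (by simp only [φ]; linarith))]
    simpa using hx.ne'

section Weak

variable {n d : ℕ} {A : (Fin n → ℝ) → Matrix (Fin d) (Fin d) ℝ}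

/-- The quadratic form `⟨a c, c⟩` at `c = ∑ⱼ bⱼ a uⱼ`. -/
def gradForm (U : Fin n → Fin d → ℝ)
    (p : Matrix (Fin d) (Fin d) ℝ × (Fin n → Matrix (Fin d) (Fin d) ℝ)) : ℝ :=
  (∑ j, p.2 j *ᵥ p.1 *ᵥ U j) ⬝ᵥ p.1 *ᵥ ∑ j, p.2 j *ᵥ p.1 *ᵥ U j

lemma continuous_gradForm (U : Fin n → Fin d → ℝ) : Continuous (gradForm U) := by
  have h : Continuous fun p : Matrix (Fin d) (Fin d) ℝ × (Fin n → Matrix (Fin d) (Fin d) ℝ) =>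
      ∑ j, p.2 j *ᵥ p.1 *ᵥ U j :=
    continuous_finsetSum _ fun j _ => ((continuous_apply j).comp continuous_snd).matrix_mulVec
      (continuous_fst.matrix_mulVec continuous_const)
  exact h.dotProduct (continuous_fst.matrix_mulVec h)

lemma exists_gradForm_bound (U : Fin n → Fin d → ℝ) (C : ℝ) :
    ∃ C', ∀ p : Matrix (Fin d) (Fin d) ℝ × (Fin n → Matrix (Fin d) (Fin d) ℝ),
      (∀ i k, |p.1 i k| ≤ C) → (∀ j i k, |p.2 j i k| ≤ C) → |gradForm U p| ≤ C' := by
  have hM : IsCompact {M : Matrix (Fin d) (Fin d) ℝ | ∀ i k, |M i k| ≤ C} := by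
    have h := isCompact_univ_pi fun _ : Fin d => isCompact_univ_pi fun _ : Fin d =>
      isCompact_Icc (a := -C) (b := C)
    have e : {M : Matrix (Fin d) (Fin d) ℝ | ∀ i k, |M i k| ≤ C} =
        Set.univ.pi fun _ : Fin d => Set.univ.pi fun _ : Fin d => Set.Icc (-C) C := by
      ext M
      exact ⟨fun h i _ k _ => abs_le.1 (h i k), fun h i k => abs_le.2 (h i trivial k trivial)⟩
    rw [e]
    exact h
  obtain ⟨C', hC'⟩ := (hM.prod (isCompact_univ_pi fun _ : Fin n => hM)).exists_bound_of_continuousOn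
    (continuous_gradForm U).continuousOn
  exact ⟨C', fun p h1 h2 => hC' p ⟨h1, fun j _ => h2 j⟩⟩

lemma quadForm_eq_gradForm (hA : MatCD 2 A) (hp : ∀ x, (A x).PosDef) (x : Fin n → ℝ)
    (U : Fin n → Fin d → ℝ) {c : Fin d → ℝ} (hc : A x *ᵥ c = ∑ j, mpd j A x *ᵥ U j) :
    c ⬝ᵥ A x *ᵥ c = gradForm U (A x, fun j => mpd j (fun y => (A y)⁻¹) x) := by
  have h : c = -∑ j, mpd j (fun y => (A y)⁻¹) x *ᵥ A x *ᵥ U j := by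
    rw [← (hp x).inv_mulVec_mulVec c, hc]
    simp only [mpd_mulVec_eq hA hp, ← mulVec_sum, Finset.sum_neg_distrib]
    exact (hp x).inv_mulVec_mulVec _
  rw [h]
  simp only [gradForm, mulVec_neg, dotProduct_neg, neg_dotProduct, neg_neg]

/-- The second-order part of the N-log-concavity condition. -/
def hessForm (A : (Fin n → ℝ) → Matrix (Fin d) (Fin d) ℝ) (U : Fin n → Fin d → ℝ)
    (x : Fin n → ℝ) : ℝ :=
  ∑ k, ∑ j, U k ⬝ᵥ mpd k (mpd j A) x *ᵥ U j

lemma nLogConcave_iff_hessForm_le (hA : MatCD 2 A) (hp : ∀ x, (A x).PosDef) :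
    NLogConcave A ↔ ∀ x U,
      hessForm A U x ≤ gradForm U (A x, fun j => mpd j (fun y => (A y)⁻¹) x) := by
  rw [nLogConcave_iff hp]
  refine ⟨fun h x U => ?_, fun h x U c hc => ?_⟩
  · have hc := (hp x).mulVec_inv_mulVec (∑ j, mpd j A x *ᵥ U j)
    exact (h x U _ hc).trans_eq (quadForm_eq_gradForm hA hp x U hc)
  · exact (h x U).trans_eq (quadForm_eq_gradForm hA hp x U hc).symm

lemma continuous_hessForm (hA : MatCD 2 A) (U : Fin n → Fin d → ℝ) :
    Continuous (hessForm A U) :=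
  continuous_finsetSum _ fun k _ => continuous_finsetSum _ fun j _ =>
    continuous_const.dotProduct
      ((matCD_mpd (m := 0) (matCD_mpd hA j) k).continuous.matrix_mulVec continuous_const)

lemma continuous_gradForm_comp (hA : MatCD 2 A) (hp : ∀ x, (A x).PosDef) (U : Fin n → Fin d → ℝ) :
    Continuous fun x => gradForm U (A x, fun j => mpd j (fun y => (A y)⁻¹) x) :=
  (continuous_gradForm U).comp (hA.continuous.prodMk
    (continuous_pi fun j => (matCD_mpd (m := 1) (hA.inv hp) j).continuous))

lemma integral_mul_hessForm (hA : MatCD 2 A) (U : Fin n → Fin d → ℝ) {φ : (Fin n → ℝ) → ℝ}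
    (hφ : ContDiff ℝ 2 φ) (hφc : HasCompactSupport φ) :
    ∫ x, φ x * hessForm A U x = ∑ k, ∑ j, ∑ a, ∑ b, U k a * U j b *
      ∫ x, fderiv ℝ (fun y => fderiv ℝ φ y (Pi.single k 1)) x (Pi.single j 1) * A x a b := by
  have hi : ∀ k j a b, Integrable fun x => U k a * U j b * (φ x * mpd k (mpd j A) x a b) :=
    fun k j a b => ((hφ.continuous.mul ((matCD_mpd (m := 0) (matCD_mpd hA j)
      k).continuous.matrix_elem a b)).integrable_of_hasCompactSupport hφc.mul_right).const_mul _
  have e : ∀ x, φ x * hessForm A U x =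
      ∑ k, ∑ j, ∑ a, ∑ b, U k a * U j b * (φ x * mpd k (mpd j A) x a b) := fun x => by
    simp only [hessForm, Matrix.mulVec, dotProduct, Finset.mul_sum]
    refine Finset.sum_congr rfl fun _ _ => Finset.sum_congr rfl fun _ _ =>
      Finset.sum_congr rfl fun _ _ => Finset.sum_congr rfl fun _ _ => by ring
  simp only [e]
  rw [integral_finsetSum _ fun k _ => integrable_finsetSum _ fun j _ =>
    integrable_finsetSum _ fun a _ => integrable_finsetSum _ fun b _ => hi k j a b]
  refine Finset.sum_congr rfl fun k _ => ?_
  rw [integral_finsetSum _ fun j _ =>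
    integrable_finsetSum _ fun a _ => integrable_finsetSum _ fun b _ => hi k j a b]
  refine Finset.sum_congr rfl fun j _ => ?_
  rw [integral_finsetSum _ fun a _ => integrable_finsetSum _ fun b _ => hi k j a b]
  refine Finset.sum_congr rfl fun a _ => ?_
  rw [integral_finsetSum _ fun b _ => hi k j a b]
  refine Finset.sum_congr rfl fun b _ => ?_
  rw [integral_const_mul, integral_mul_mpd_mpd hA hφ hφc]

end Weak

lemma Matrix.IsSymm.abs_apply_le {d : ℕ} {M : Matrix (Fin d) (Fin d) ℝ} (hM : M.IsSymm)
    {q : (Fin d → ℝ) → ℝ} (hq : ∀ v, |v ⬝ᵥ M *ᵥ v| ≤ q v) (i k : Fin d) :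
    |M i k| ≤ ∑ a, ∑ b, (q (Pi.single a 1 + Pi.single b 1) + q (Pi.single a 1)
      + q (Pi.single b 1)) := by
  have hq0 : ∀ v, 0 ≤ q v := fun v => (abs_nonneg _).trans (hq v)
  have h : |M i k| ≤ q (Pi.single i 1 + Pi.single k 1) + q (Pi.single i 1) + q (Pi.single k 1) := by
    rw [hM.apply_eq_quadForm i k]
    have h1 := abs_le.1 (hq (Pi.single i 1 + Pi.single k 1))
    have h2 := abs_le.1 (hq (Pi.single i 1))
    have h3 := abs_le.1 (hq (Pi.single k 1))
    have h4 := hq0 (Pi.single i 1 + Pi.single k 1)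
    have h5 := hq0 (Pi.single i 1)
    have h6 := hq0 (Pi.single k 1)
    rw [abs_le]
    constructor <;> linarith
  have hn : ∀ a b : Fin d, 0 ≤ q (Pi.single a 1 + Pi.single b 1) + q (Pi.single a 1)
      + q (Pi.single b 1) := fun a b => add_nonneg (add_nonneg (hq0 _) (hq0 _)) (hq0 _)
  exact h.trans ((Finset.single_le_sum (f := fun b => q (Pi.single i 1 + Pi.single b 1) +
    q (Pi.single i 1) + q (Pi.single b 1)) (fun b _ => hn i b) (Finset.mem_univ k)).trans
    (Finset.single_le_sum (f := fun a => ∑ b, (q (Pi.single a 1 + Pi.single b 1) +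
      q (Pi.single a 1) + q (Pi.single b 1))) (fun a _ => Finset.sum_nonneg fun b _ => hn a b)
      (Finset.mem_univ i)))

lemma exists_entry_bound {X : Type*} [TopologicalSpace X] {d : ℕ} {q : X → (Fin d → ℝ) → ℝ}
    (hq : ∀ v, Continuous fun x => q x v) {K : Set X} (hK : IsCompact K) :
    ∃ C, ∀ (M : Matrix (Fin d) (Fin d) ℝ), M.IsSymm → ∀ x ∈ K,
      (∀ v, |v ⬝ᵥ M *ᵥ v| ≤ q x v) → ∀ i k, |M i k| ≤ C := by
  have hc : Continuous fun x => ∑ a : Fin d, ∑ b : Fin d, (q x (Pi.single a 1 + Pi.single b 1)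
      + q x (Pi.single a 1) + q x (Pi.single b 1)) := by
    refine continuous_finsetSum _ fun a _ => continuous_finsetSum _ fun b _ => ?_
    exact ((hq (Pi.single a 1 + Pi.single b 1)).add (hq (Pi.single a 1))).add
      (hq (Pi.single b 1))
  obtain ⟨C, hC⟩ := hK.exists_bound_of_continuousOn hc.continuousOn
  exact ⟨C, fun M hM x hx h i k =>
    (hM.abs_apply_le h i k).trans ((le_abs_self _).trans (hC x hx))⟩

/-- N-log-concavity passes to monotone pointwise limits. -/
theorem nLogConcave_of_tendsto {n d : ℕ} {A : ℕ → (Fin n → ℝ) → Matrix (Fin d) (Fin d) ℝ}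
    {α : (Fin n → ℝ) → Matrix (Fin d) (Fin d) ℝ} (hA : ∀ m, MatCD 2 (A m))
    (hAp : ∀ m x, (A m x).PosDef) (hlc : ∀ m, NLogConcave (A m)) (hα : MatCD 2 α)
    (hαp : ∀ x, (α x).PosDef)
    (hlim : ∀ x i k, Tendsto (fun m => A m x i k) atTop (𝓝 (α x i k)))
    (hlow : ∀ m x v, v ⬝ᵥ A 0 x *ᵥ v ≤ v ⬝ᵥ A m x *ᵥ v)
    (hupp : ∀ m x v, v ⬝ᵥ A m x *ᵥ v ≤ v ⬝ᵥ α x *ᵥ v) : NLogConcave α := by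
  have hsymm : ∀ m x, (A m x).IsSymm := fun m x => (hAp m x).isSymm_real
  have hisymm : ∀ m j x, (mpd j (fun y => (A m y)⁻¹) x).IsSymm := fun m =>
    isSymm_mpd fun x => (hAp m x).inv.isSymm_real
  have hlimM : ∀ x, Tendsto (fun m => A m x) atTop (𝓝 (α x)) := fun x =>
    tendsto_pi_nhds.2 fun i => tendsto_pi_nhds.2 fun k => hlim x i k
  have hlimI : ∀ x, Tendsto (fun m => (A m x)⁻¹) atTop (𝓝 (α x)⁻¹) := fun x => by
    have h : ContinuousAt Inv.inv (α x) := continuousAt_matrix_inv _ (by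
      rw [Ring.inverse_eq_inv']
      exact continuousAt_inv₀ (hαp x).det_pos.ne')
    exact h.tendsto.comp (hlimM x)
  have hlimQ : ∀ j x (v : Fin d → ℝ), Tendsto
      (fun m => v ⬝ᵥ mpd j (fun y => (A m y)⁻¹) x *ᵥ v) atTop
      (𝓝 (v ⬝ᵥ mpd j (fun y => (α y)⁻¹) x *ᵥ v)) := fun j x v => by
    have h := tendsto_deriv_of_convexOn
      (fun m => convexOn_inv_quadForm_line (hA m) (hAp m) (hlc m) x j v)
      (fun m => hasDerivAt_inv_quadForm_line (hA m) (hAp m) x j v 0)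
      (hasDerivAt_inv_quadForm_line hα hαp x j v 0)
      fun s => (((continuous_const (y := v)).dotProduct (continuous_id.matrix_mulVec
        (continuous_const (y := v)))).tendsto _).comp (hlimI _)
    simpa using h
  have hlimD : ∀ x, Tendsto (fun m j => mpd j (fun y => (A m y)⁻¹) x) atTop
      (𝓝 fun j => mpd j (fun y => (α y)⁻¹) x) := fun x => by
    refine tendsto_pi_nhds.2 fun j => tendsto_pi_nhds.2 fun i => tendsto_pi_nhds.2 fun k => ?_
    rw [(isSymm_mpd (fun x => (hαp x).inv.isSymm_real) j x).apply_eq_quadForm i k]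
    simp only [(hisymm _ j x).apply_eq_quadForm i k]
    exact (((hlimQ j x _).sub (hlimQ j x _)).sub (hlimQ j x _)).div_const 2
  have hbA : ∀ K, IsCompact K → ∃ C, ∀ m, ∀ x ∈ K, ∀ i k, |A m x i k| ≤ C := fun K hK => by
    obtain ⟨C, hC⟩ := exists_entry_bound (q := fun x v => v ⬝ᵥ α x *ᵥ v) (fun v =>
      continuous_const.dotProduct (hα.continuous.matrix_mulVec continuous_const)) hK
    refine ⟨C, fun m x hx => hC _ (hsymm m x) x hx fun v => ?_⟩
    rw [abs_of_nonneg ((hAp m x).dotProduct_mulVec_nonneg_real v)]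
    exact hupp m x v
  have hbD : ∀ K, IsCompact K → ∀ j, ∃ C, ∀ m, ∀ x ∈ K, ∀ i k,
      |mpd j (fun y => (A m y)⁻¹) x i k| ≤ C := fun K hK j => by
    have hc0 : ∀ (s : ℝ) (v : Fin d → ℝ),
        Continuous fun x => v ⬝ᵥ (A 0 (x + s • Pi.single j 1))⁻¹ *ᵥ v := fun s v =>
      continuous_const.dotProduct ((((hA 0).inv (hAp 0)).continuous.comp
        (continuous_id.add continuous_const)).matrix_mulVec continuous_const)
    obtain ⟨C, hC⟩ := exists_entry_bound (q := fun x v =>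
      v ⬝ᵥ (A 0 (x + (1 : ℝ) • Pi.single j 1))⁻¹ *ᵥ v +
      v ⬝ᵥ (A 0 (x + (-1 : ℝ) • Pi.single j 1))⁻¹ *ᵥ v)
      (fun v => (hc0 1 v).add (hc0 (-1) v)) hK
    refine ⟨C, fun m x hx => hC _ (hisymm m j x) x hx fun v => ?_⟩
    have h := abs_deriv_le_of_convexOn
      (convexOn_inv_quadForm_line (hA m) (hAp m) (hlc m) x j v)
      (hasDerivAt_inv_quadForm_line (hA m) (hAp m) x j v 0)
      fun s => (hAp m _).inv.dotProduct_mulVec_nonneg_real v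
    rw [zero_smul, add_zero] at h
    exact h.trans (add_le_add
      ((hAp 0 _).inv_quadForm_le (hAp m _) (hlow m _) v)
      ((hAp 0 _).inv_quadForm_le (hAp m _) (hlow m _) v))
  rw [nLogConcave_iff_hessForm_le hα hαp]
  intro x U
  rw [← sub_nonpos]
  refine nonpos_of_integral_bump_nonpos (h := fun x => hessForm α U x -
    gradForm U (α x, fun j => mpd j (fun y => (α y)⁻¹) x))
    ((continuous_hessForm hα U).sub (continuous_gradForm_comp hα hαp U))
    (fun φ hφ hφc hφ0 => ?_) x
  have hint : ∀ {f : (Fin n → ℝ) → ℝ}, Continuous f → Integrable fun x => φ x * f x :=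
    fun hf => (hφ.continuous.mul hf).integrable_of_hasCompactSupport hφc.mul_right
  simp only [mul_sub]
  rw [integral_sub (hint (continuous_hessForm hα U)) (hint (continuous_gradForm_comp hα hαp U)),
    sub_nonpos]
  have hhess : Tendsto (fun m => ∫ x, φ x * hessForm (A m) U x) atTop
      (𝓝 (∫ x, φ x * hessForm α U x)) := by
    simp only [integral_mul_hessForm (hA _) U hφ hφc, integral_mul_hessForm hα U hφ hφc]
    refine tendsto_finsetSum _ fun k _ => tendsto_finsetSum _ fun j _ =>
      tendsto_finsetSum _ fun a _ => tendsto_finsetSum _ fun b _ => Tendsto.const_mul _ ?_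
    have hφ₁ : ContDiff ℝ 1 fun y => fderiv ℝ φ y (Pi.single k 1) :=
      (hφ.fderiv_right (m := 1) (by norm_num [one_add_one_eq_two])).clm_apply contDiff_const
    refine tendsto_integral_mul_of_locallyBounded
      ((hφ₁.continuous_fderiv (by norm_num)).clm_apply continuous_const)
      ((hφc.fderiv_apply ℝ _).fderiv_apply ℝ _) (fun m => (hA m).continuous.matrix_elem a b)
      (fun x => hlim x a b) fun K hK => ?_
    obtain ⟨C, hC⟩ := hbA K hK
    exact ⟨C, fun m x hx => hC m x hx a b⟩
  have hgrad : Tendsto (fun m => ∫ x, φ x * gradForm U (A m x, fun j =>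
      mpd j (fun y => (A m y)⁻¹) x)) atTop
      (𝓝 (∫ x, φ x * gradForm U (α x, fun j => mpd j (fun y => (α y)⁻¹) x))) := by
    refine tendsto_integral_mul_of_locallyBounded hφ.continuous hφc
      (fun m => continuous_gradForm_comp (hA m) (hAp m) U) (fun x => ?_) fun K hK => ?_
    · exact ((continuous_gradForm U).tendsto _).comp ((hlimM x).prodMk_nhds (hlimD x))
    · obtain ⟨C, hC⟩ := hbA K hK
      choose D hD using hbD K hK
      obtain ⟨C', hC'⟩ := exists_gradForm_bound U (max C (∑ j, |D j|))
      refine ⟨C', fun m x hx => hC' _ (fun i k => (hC m x hx i k).trans (le_max_left _ _))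
        fun j i k => (hD j m x hx i k).trans ((le_abs_self _).trans ?_)⟩
      exact (Finset.single_le_sum (f := fun j => |D j|) (fun j _ => abs_nonneg _)
        (Finset.mem_univ j)).trans (le_max_right _ _)
  refine le_of_tendsto_of_tendsto' hhess hgrad fun m => ?_
  refine integral_mono (hint (continuous_hessForm (hA m) U))
    (hint (continuous_gradForm_comp (hA m) (hAp m) U)) fun x => ?_
  exact mul_le_mul_of_nonneg_left
    ((nLogConcave_iff_hessForm_le (hA m) (hAp m)).1 (hlc m) x U) (hφ0 x)

end MatrixPrekopaAux

/-- **Raufi's matrix-valued Prékopa theorem.** If `g : ℝ^{n0+n1} → Sym⁺_d(ℝ)` is `C²`,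
N-log-concave and fibrewise integrable, and the marginal `α(t) = ∫ g(t,y) dy` is `C²` with
positive definite values, with derivatives given by differentiation under the integral sign,
then `α` is N-log-concave on `ℝ^{n0}`. -/
theorem matrix_prekopa (n0 n1 d : ℕ) (hn0 : 1 ≤ n0) (hn1 : 1 ≤ n1) (hd : 1 ≤ d)
    (g : (Fin (n0 + n1) → ℝ) → Matrix (Fin d) (Fin d) ℝ)
    (hg : MatCD 2 g) (hgsymm : ∀ x, (g x).PosDef) (hglc : NLogConcave g)
    (hgint : ∀ (t : Fin n0 → ℝ) (i k : Fin d),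
      Integrable fun y : Fin n1 → ℝ => g (Fin.append t y) i k)
    (α : (Fin n0 → ℝ) → Matrix (Fin d) (Fin d) ℝ)
    (hα_def : ∀ t i k, α t i k = ∫ y : Fin n1 → ℝ, g (Fin.append t y) i k)
    (hα : MatCD 2 α) (hαpos : ∀ t, (α t).PosDef)
    (hα1 : ∀ (t : Fin n0 → ℝ) (j : Fin n0) (i k : Fin d),
      mpd j α t i k = ∫ y : Fin n1 → ℝ, mpd (Fin.castAdd n1 j) g (Fin.append t y) i k)
    (hα2 : ∀ (t : Fin n0 → ℝ) (j l : Fin n0) (i k : Fin d),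
      mpd l (mpd j α) t i k =
        ∫ y : Fin n1 → ℝ,
          mpd (Fin.castAdd n1 l) (mpd (Fin.castAdd n1 j) g) (Fin.append t y) i k) :
    NLogConcave α := by
  have hg0 : MatCD 0 g := hg.of_le (by norm_num)
  have hR : ∀ m : ℕ, (0 : ℝ) < m + 1 := fun m => by positivity
  have hmono : Monotone fun m : ℕ => cube n1 ((m : ℝ) + 1) := fun a b h =>
    cube_mono n1 (by simpa using h)
  have happly : ∀ (m : ℕ) t, boxInt ((m : ℝ) + 1) n1 g t =
      Matrix.of fun i k => ∫ y in cube n1 ((m : ℝ) + 1), g (Fin.append t y) i k := fun m t => by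
    ext i k
    exact boxInt_apply (hR m).le hg0 t i k
  have hαeq : ∀ t, α t = Matrix.of fun i k => ∫ y : Fin n1 → ℝ, g (Fin.append t y) i k := by
    intro t
    ext i k
    exact hα_def t i k
  have hnonneg : ∀ (t : Fin n0 → ℝ) v (y : Fin n1 → ℝ), 0 ≤ v ⬝ᵥ g (Fin.append t y) *ᵥ v :=
    fun t v y => (hgsymm _).dotProduct_mulVec_nonneg_real v
  have hint : ∀ (t : Fin n0 → ℝ) v,
      Integrable fun y : Fin n1 → ℝ => v ⬝ᵥ g (Fin.append t y) *ᵥ v := fun t v =>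
    integrable_finsetSum _ fun i _ => ((integrable_mulVec (hgint t) v).eval i).const_mul (v i)
  have hquad : ∀ (m : ℕ) t v, v ⬝ᵥ boxInt ((m : ℝ) + 1) n1 g t *ᵥ v =
      ∫ y in cube n1 ((m : ℝ) + 1), v ⬝ᵥ g (Fin.append t y) *ᵥ v := fun m t v => by
    rw [happly, dotProduct_integral_mulVec fun i k => (hgint t i k).integrableOn]
  refine nLogConcave_of_tendsto (A := fun m : ℕ => boxInt ((m : ℝ) + 1) n1 g)
    (fun m => (boxInt_regular (hR m) hg hgsymm hglc).1)
    (fun m => (boxInt_regular (hR m) hg hgsymm hglc).2.1)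
    (fun m => (boxInt_regular (hR m) hg hgsymm hglc).2.2) hα hαpos (fun t i k => ?_)
    (fun m t v => ?_) fun m t v => ?_
  · have h := tendsto_setIntegral_of_monotone
      (fun m : ℕ => measurableSet_cube n1 ((m : ℝ) + 1)) hmono (hgint t i k).integrableOn
    rw [iUnion_cube, setIntegral_univ] at h
    simp only [happly, of_apply, hα_def]
    exact h
  · simp only [hquad]
    exact setIntegral_mono_set (hint t v).integrableOn (ae_of_all _ (hnonneg t v))
      (hmono m.zero_le).eventuallyLE
  · simp only [hquad]
    rw [hαeq, dotProduct_integral_mulVec (hgint t)]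
    exact setIntegral_le_integral (hint t v) (ae_of_all _ (hnonneg t v))
end
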